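/- Let ϖ₀ ∈ ℝ with |ϖ₀| ≤ R, and let ϖ : [0,∞) → ℝ be a continuous function satisfying, for every t ≥ 0, the Duhamel integral equation ϖ(t) = S(t,0)·ϖ₀ + ∫_0^t S(t,τ)·|h(τ)|·|ϖ(τ)|^p·ϖ(τ) dτ (equivalently, ϖ solves the scalar ODE ϖ̇ = −(μ̄ − |h|·(1 + |ϖ|^p))·ϖ with ϖ(0) = ϖ₀). Then |ϖ(t)| ≤ ρ·e^{−μ₀(t−s)}·|ϖ(s)| for all real t ≥ s ≥ 0; since μ₀ ≥ μ, the equation is exponentially stable with transient bound ρ and rate −μ₀ ≤ −μ. -/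

import Mathlib

open MeasureTheory

theorem AbsolutelyContinuousOnInterval.rexp_comp {f : ℝ → ℝ} {a b : ℝ}
    (hf : AbsolutelyContinuousOnInterval f a b) :
    AbsolutelyContinuousOnInterval (fun x => Real.exp (f x)) a b := by
  obtain ⟨C, hC⟩ := hf.exists_bound
  obtain ⟨K, hK⟩ := (Real.contDiff_exp (n := 1)).contDiffOn.exists_lipschitzOnWith
    (by decide) (convex_Icc (-C) C) isCompact_Icc
  rw [absolutelyContinuousOnInterval_iff] at hf ⊢
  intro ε hε
  obtain ⟨δ, hδ, H⟩ := hf (ε / (K + 1)) (by positivity)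
  refine ⟨δ, hδ, fun E hE hlen => ?_⟩
  have hsum := H E hE hlen
  have hmem : ∀ x ∈ Set.uIcc a b, f x ∈ Set.Icc (-C) C := fun x hx =>
    abs_le.mp (by simpa using hC x hx)
  calc ∑ i ∈ Finset.range E.1, dist (Real.exp (f (E.2 i).1)) (Real.exp (f (E.2 i).2))
      ≤ ∑ i ∈ Finset.range E.1, K * dist (f (E.2 i).1) (f (E.2 i).2) :=
        Finset.sum_le_sum fun i hi =>
          hK.dist_le_mul _ (hmem _ (hE.1 i hi).1) _ (hmem _ (hE.1 i hi).2)
    _ = K * ∑ i ∈ Finset.range E.1, dist (f (E.2 i).1) (f (E.2 i).2) :=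
        (Finset.mul_sum _ _ _).symm
    _ ≤ K * (ε / (K + 1)) := by gcongr
    _ < (K + 1) * (ε / (K + 1)) := by gcongr; linarith
    _ = ε := by field

/-- A continuous solution of the linear Volterra equation `v = C + ∫ g v` with integrable
coefficient `g` is an exponential. -/
theorem eq_mul_exp_of_eq_add_integral {g v : ℝ → ℝ} {a b C : ℝ} (hab : a ≤ b)
    (hg : IntervalIntegrable g volume a b) (hv : ContinuousOn v (Set.Icc a b))
    (heq : ∀ t ∈ Set.Icc a b, v t = C + ∫ τ in a..t, g τ * v τ) :
    ∀ t ∈ Set.Icc a b, v t = C * Real.exp (∫ τ in a..t, g τ) := by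
  rw [← Set.uIcc_of_le hab] at hv heq ⊢
  have hgv : IntervalIntegrable (fun τ => g τ * v τ) volume a b := hg.mul_continuousOn hv
  have hV := hgv.absolutelyContinuousOnInterval_intervalIntegral (Set.left_mem_uIcc)
  have hG := hg.absolutelyContinuousOnInterval_intervalIntegral (Set.left_mem_uIcc)
  have hC : AbsolutelyContinuousOnInterval (fun _ : ℝ => C) a b :=
    contDiffOn_const.absolutelyContinuousOnInterval
  have hU := (hC.fun_add hV).fun_mul hG.fun_neg.rexp_comp
  have hderiv : ∀ᵐ x, x ∈ Set.uIcc a b → HasDerivAt (fun x =>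
      (C + ∫ τ in a..x, g τ * v τ) * Real.exp (-∫ τ in a..x, g τ)) 0 x := by
    filter_upwards [hgv.ae_hasDerivAt_integral, hg.ae_hasDerivAt_integral] with x h1 h2 hx
    have e1 := (h1 hx a Set.left_mem_uIcc).const_add C
    have e2 := (h2 hx a Set.left_mem_uIcc).fun_neg.exp
    refine (e1.fun_mul e2).congr_deriv ?_
    rw [← heq x hx]
    ring
  obtain ⟨c, hc⟩ := hU.const_of_ae_hasDerivAt_zero hderiv
  have hca := hc a Set.left_mem_uIcc
  simp only [intervalIntegral.integral_same, add_zero, neg_zero, Real.exp_zero, mul_one] at hca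
  intro t ht
  have hct := hc t ht
  rw [← heq t ht, Real.exp_neg, ← hca] at hct
  rw [← hct]
  field_simp

/-- Young's inequality with a free parameter `l`, the conjugate factor being constant. -/
theorem le_rpow_div_add_of_one_lt {r x l : ℝ} (hr : 1 < r) (hx : 0 ≤ x) (hl : 0 < l) :
    x ≤ x ^ r * ((l ^ (r - 1))⁻¹ / r) + l * ((r - 1) / r) := by
  have hr0 : 0 < r := by linarith
  have hr1 : 0 < r - 1 := by linarith
  have hpow : 0 < l ^ ((r - 1) / r) := by positivity
  have key := Real.young_inequality_of_nonneg (a := x / l ^ ((r - 1) / r))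
    (b := l ^ ((r - 1) / r)) (by positivity) hpow.le (Real.HolderConjugate.conjExponent hr)
  rw [div_mul_cancel₀ _ hpow.ne', Real.div_rpow hx hpow.le, ← Real.rpow_mul hl.le,
    ← Real.rpow_mul hl.le, div_mul_cancel₀ _ hr0.ne', Real.conjExponent,
    show (r - 1) / r * (r / (r - 1)) = 1 by field_simp, Real.rpow_one] at key
  refine key.trans (le_of_eq ?_)
  field_simp

section WindowBounds

variable {T Ch r : ℝ} {h : ℝ → ℝ}

theorem intervalIntegrable_abs_of_rpow (hr : 1 < r) (hmeas : Measurable h)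
    (hloc : ∀ a b : ℝ, 0 ≤ a → IntegrableOn (fun τ => |h τ| ^ r) (Set.Icc a b))
    {s t : ℝ} (hs : 0 ≤ s) (hst : s ≤ t) :
    IntervalIntegrable (fun τ => |h τ|) volume s t := by
  rw [intervalIntegrable_iff_integrableOn_Icc_of_le hst]
  refine Integrable.mono' (g := fun τ => |h τ| ^ r + 1) ((hloc s t hs).add (by simp))
    hmeas.abs.aestronglyMeasurable (ae_of_all _ fun τ => ?_)
  rw [Real.norm_eq_abs, abs_abs]
  rcases le_total |h τ| 1 with h1 | h1
  · have : 0 ≤ |h τ| ^ r := by positivity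
    linarith
  · have := Real.rpow_le_rpow_of_exponent_le h1 hr.le
    rw [Real.rpow_one] at this
    linarith

/-- On a window of length at most `T`, the integral of `|h|` is controlled by Young's
inequality with an arbitrary parameter. -/
theorem integral_abs_le_of_window (hr : 1 < r) (hmeas : Measurable h)
    (hloc : ∀ a b : ℝ, 0 ≤ a → IntegrableOn (fun τ => |h τ| ^ r) (Set.Icc a b))
    (hbound : ∀ s : ℝ, 0 ≤ s → (∫ τ in s..(s + T), |h τ| ^ r) ≤ Ch ^ r)
    {s t l : ℝ} (hs : 0 ≤ s) (hst : s ≤ t) (htT : t ≤ s + T) (hl : 0 < l) :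
    ∫ τ in s..t, |h τ| ≤ Ch ^ r * ((l ^ (r - 1))⁻¹ / r) + l * ((r - 1) / r) * (t - s) := by
  have hI : ∀ u, s ≤ u → IntervalIntegrable (fun τ => |h τ| ^ r) volume s u := fun u hu =>
    (intervalIntegrable_iff_integrableOn_Icc_of_le hu).2 (hloc s u hs)
  have hmono : ∫ τ in s..t, |h τ| ^ r ≤ Ch ^ r :=
    (intervalIntegral.integral_mono_interval le_rfl hst htT
      (ae_of_all _ fun τ => by positivity) (hI _ (hst.trans htT))).trans (hbound s hs)
  calc ∫ τ in s..t, |h τ|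
      ≤ ∫ τ in s..t, (|h τ| ^ r * ((l ^ (r - 1))⁻¹ / r) + l * ((r - 1) / r)) :=
        intervalIntegral.integral_mono_on hst (intervalIntegrable_abs_of_rpow hr hmeas hloc hs hst)
          (((hI t hst).mul_const _).add intervalIntegrable_const)
          fun τ _ => le_rpow_div_add_of_one_lt hr (abs_nonneg _) hl
    _ = (∫ τ in s..t, |h τ| ^ r) * ((l ^ (r - 1))⁻¹ / r) + l * ((r - 1) / r) * (t - s) := by
        rw [intervalIntegral.integral_add ((hI t hst).mul_const _) intervalIntegrable_const,
          intervalIntegral.integral_mul_const, intervalIntegral.integral_const, smul_eq_mul]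
        ring
    _ ≤ _ := by
        have : 0 ≤ (l ^ (r - 1))⁻¹ / r := by positivity
        gcongr

/-- Induction on the number of windows of length `T` covering an interval. -/
theorem window_induction {P : ℝ → ℝ → Prop} (hT : 0 < T)
    (hbase : ∀ s t : ℝ, 0 ≤ s → s ≤ t → t ≤ s + T → P s t)
    (hstep : ∀ s t : ℝ, 0 ≤ s → s + T ≤ t → P (s + T) t → P s t)
    {s t : ℝ} (hs : 0 ≤ s) (hst : s ≤ t) : P s t := by
  obtain ⟨n, hn⟩ := exists_nat_ge ((t - s) / T)
  rw [div_le_iff₀ hT] at hn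
  induction n generalizing s with
  | zero => exact hbase s t hs hst (by simp at hn; linarith)
  | succ n ih =>
    rcases le_total t (s + T) with h1 | h1
    · exact hbase s t hs hst h1
    · refine hstep s t hs h1 (ih (by linarith) h1 ?_)
      push_cast at hn
      linarith

theorem integral_abs_le (hT : 0 < T) (hCh : 0 < Ch) (hr : 1 < r) (hmeas : Measurable h)
    (hloc : ∀ a b : ℝ, 0 ≤ a → IntegrableOn (fun τ => |h τ| ^ r) (Set.Icc a b))
    (hbound : ∀ s : ℝ, 0 ≤ s → (∫ τ in s..(s + T), |h τ| ^ r) ≤ Ch ^ r)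
    {s t l : ℝ} (hs : 0 ≤ s) (hst : s ≤ t) (hl : 0 < l) :
    ∫ τ in s..t, |h τ| ≤ (T ^ (-1 / r) * Ch + l * ((r - 1) / r)) * (t - s) +
      Ch ^ r * ((l ^ (r - 1))⁻¹ / r) := by
  have hr0 : 0 < r := by linarith
  have hr1 : 0 < r - 1 := by linarith
  refine window_induction (P := fun s t => ∫ τ in s..t, |h τ| ≤
    (T ^ (-1 / r) * Ch + l * ((r - 1) / r)) * (t - s) + Ch ^ r * ((l ^ (r - 1))⁻¹ / r))
    hT (fun s t hs hst htT => ?_) (fun s t hs hst ih => ?_) hs hst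
  · have h1 := integral_abs_le_of_window hr hmeas hloc hbound hs hst htT hl
    have h2 : 0 ≤ T ^ (-1 / r) * Ch * (t - s) := mul_nonneg (by positivity) (by linarith)
    linarith
  · have hT0 : s ≤ s + T := by linarith
    have h1 := integral_abs_le_of_window hr hmeas hloc hbound hs hT0 le_rfl
      (show 0 < T ^ (-1 / r) * Ch by positivity)
    have h2 : Ch ^ r * (((T ^ (-1 / r) * Ch) ^ (r - 1))⁻¹ / r) +
        T ^ (-1 / r) * Ch * ((r - 1) / r) * (s + T - s) = T ^ (-1 / r) * Ch * T := by
      have e1 : ((T ^ (-1 / r) * Ch) ^ (r - 1))⁻¹ = T * T ^ (-1 / r) * (Ch / Ch ^ r) := by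
        rw [Real.mul_rpow (by positivity) hCh.le, ← Real.rpow_mul hT.le, mul_inv,
          ← Real.rpow_neg hT.le, Real.rpow_sub hCh, Real.rpow_one, inv_div]
        congr 1
        nth_rewrite 2 [← Real.rpow_one T]
        rw [← Real.rpow_add hT]
        congr 1
        field_simp
        ring
      rw [e1]
      have : Ch ^ r ≠ 0 := by positivity
      field_simp
      ring
    have h3 : 0 ≤ l * ((r - 1) / r) * T := by positivity
    rw [← intervalIntegral.integral_add_adjacent_intervals
      (intervalIntegrable_abs_of_rpow hr hmeas hloc hs hT0)
      (intervalIntegrable_abs_of_rpow hr hmeas hloc (by linarith) hst)]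
    linarith

theorem integral_abs_mul_exp_le (hT : 0 < T) (hCh : 0 < Ch) (hr : 1 < r) (hmeas : Measurable h)
    (hloc : ∀ a b : ℝ, 0 ≤ a → IntegrableOn (fun τ => |h τ| ^ r) (Set.Icc a b))
    (hbound : ∀ s : ℝ, 0 ≤ s → (∫ τ in s..(s + T), |h τ| ^ r) ≤ Ch ^ r)
    {s t l m : ℝ} (hs : 0 ≤ s) (hst : s ≤ t) (hl : 0 < l) (hm : 0 ≤ m)
    (hmT : Real.exp (-(m * T)) ≤ 1 / 2) :
    ∫ τ in s..t, |h τ| * Real.exp (-(m * (τ - s))) ≤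
      l * ((r - 1) / r) * (t - s) + 2 * (Ch ^ r * ((l ^ (r - 1))⁻¹ / r)) := by
  have hr0 : 0 < r := by linarith
  have hr1 : 0 < r - 1 := by linarith
  have hX : 0 ≤ Ch ^ r * ((l ^ (r - 1))⁻¹ / r) := by positivity
  have hint : ∀ s t u : ℝ, 0 ≤ s → s ≤ t →
      IntervalIntegrable (fun τ => |h τ| * Real.exp (-(m * (τ - u)))) volume s t :=
    fun s t u hs hst => (intervalIntegrable_abs_of_rpow hr hmeas hloc hs hst).mul_continuousOn
      (by fun_prop)
  have hwin : ∀ s t : ℝ, 0 ≤ s → s ≤ t → t ≤ s + T →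
      ∫ τ in s..t, |h τ| * Real.exp (-(m * (τ - s))) ≤
        Ch ^ r * ((l ^ (r - 1))⁻¹ / r) + l * ((r - 1) / r) * (t - s) := by
    intro s t hs hst htT
    refine le_trans (intervalIntegral.integral_mono_on hst (hint s t s hs hst)
      (intervalIntegrable_abs_of_rpow hr hmeas hloc hs hst) fun τ hτ => ?_)
      (integral_abs_le_of_window hr hmeas hloc hbound hs hst htT hl)
    refine mul_le_of_le_one_right (abs_nonneg _) (Real.exp_le_one_iff.2 ?_)
    have := mul_nonneg hm (sub_nonneg.2 hτ.1)
    linarith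
  refine window_induction (P := fun s t => ∫ τ in s..t, |h τ| * Real.exp (-(m * (τ - s))) ≤
    l * ((r - 1) / r) * (t - s) + 2 * (Ch ^ r * ((l ^ (r - 1))⁻¹ / r)))
    hT (fun s t hs hst htT => ?_) (fun s t hs hst ih => ?_) hs hst
  · linarith [hwin s t hs hst htT]
  · have hT0 : s ≤ s + T := by linarith
    have h1 := hwin s (s + T) hs hT0 le_rfl
    have h2 : ∫ τ in (s + T)..t, |h τ| * Real.exp (-(m * (τ - s))) =
        Real.exp (-(m * T)) * ∫ τ in (s + T)..t, |h τ| * Real.exp (-(m * (τ - (s + T)))) := by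
      rw [← intervalIntegral.integral_const_mul]
      congr 1
      ext τ
      rw [mul_left_comm, ← Real.exp_add]
      congr 2
      ring
    have h3 : 0 ≤ ∫ τ in (s + T)..t, |h τ| * Real.exp (-(m * (τ - (s + T)))) :=
      intervalIntegral.integral_nonneg hst fun τ _ => by positivity
    have h4 : 0 ≤ l * ((r - 1) / r) * (t - (s + T)) :=
      mul_nonneg (by positivity) (by linarith)
    rw [← intervalIntegral.integral_add_adjacent_intervals (hint s (s + T) s hs hT0)
      (hint (s + T) t s (by linarith) hst), h2]
    have h5 := mul_le_mul_of_nonneg_right hmT h3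
    linarith

end WindowBounds

/-- A continuous function that starts strictly below `B`, and is strictly below `B` at every time
before which it was strictly below `B`, stays below `B`. -/
theorem lt_of_forall_lt_imp_lt {f : ℝ → ℝ} {B : ℝ} (hf : ContinuousOn f (Set.Ici 0))
    (hstep : ∀ t : ℝ, 0 ≤ t → (∀ τ, 0 ≤ τ → τ < t → f τ < B) → f t < B) :
    ∀ t : ℝ, 0 ≤ t → f t < B := by
  by_contra! hne
  have hclosed : IsClosed (Set.Ici 0 ∩ f ⁻¹' Set.Ici B) :=
    hf.preimage_isClosed_of_isClosed isClosed_Ici isClosed_Ici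
  have hbdd : BddBelow (Set.Ici 0 ∩ f ⁻¹' Set.Ici B) := ⟨0, fun x hx => hx.1⟩
  obtain ⟨t, ht0, htB⟩ := hne
  have hmem := hclosed.csInf_mem ⟨t, ht0, htB⟩ hbdd
  refine absurd (hstep _ hmem.1 fun τ hτ0 hτ => ?_) (not_lt.2 hmem.2)
  by_contra! hB
  exact absurd (csInf_le hbdd ⟨hτ0, hB⟩) (not_le.2 hτ)

/-- The Duhamel equation integrates to an exponential formula for the solution. -/
theorem eq_mul_exp_of_duhamel {h w : ℝ → ℝ} {m p w₀ : ℝ} (hp : 0 < p)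
    (hh : ∀ s t : ℝ, 0 ≤ s → s ≤ t → IntervalIntegrable (fun τ => |h τ|) volume s t)
    (hwcont : ContinuousOn w (Set.Ici (0 : ℝ)))
    (hduhamel : ∀ t : ℝ, 0 ≤ t →
      w t = Real.exp (-m * (t - 0) + ∫ τ in (0:ℝ)..t, |h τ|) * w₀ +
        ∫ τ in (0:ℝ)..t,
          Real.exp (-m * (t - τ) + ∫ σ in τ..t, |h σ|) * |h τ| * |w τ| ^ p * w τ)
    {s t : ℝ} (hs : 0 ≤ s) (hst : s ≤ t) :
    w t = w s * Real.exp (-m * (t - s) + (∫ τ in s..t, |h τ|) +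
      ∫ τ in s..t, |h τ| * |w τ| ^ p) := by
  have ht : 0 ≤ t := hs.trans hst
  have hwp : ∀ a b : ℝ, 0 ≤ a → a ≤ b →
      IntervalIntegrable (fun τ => |h τ| * |w τ| ^ p) volume a b := fun a b ha hab =>
    (hh a b ha hab).mul_continuousOn <| by
      rw [Set.uIcc_of_le hab]
      exact ((hwcont.mono fun x hx => ha.trans hx.1).abs).rpow_const fun _ _ => Or.inr hp.le
  have hHcont : ContinuousOn (fun x => ∫ τ in (0:ℝ)..x, |h τ|) (Set.Icc 0 t) := by
    rw [← Set.uIcc_of_le ht]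
    exact intervalIntegral.continuousOn_primitive_interval
      ((intervalIntegrable_iff' (by simp)).1 (hh 0 t le_rfl ht))
  have hvcont : ContinuousOn (fun τ => w τ * Real.exp (m * τ - ∫ σ in (0:ℝ)..τ, |h σ|))
      (Set.Icc 0 t) :=
    (hwcont.mono Set.Icc_subset_Ici_self).mul
      (((continuousOn_const.mul continuousOn_id).sub hHcont).rexp)
  have hsol := eq_mul_exp_of_eq_add_integral (C := w₀) ht (hwp 0 t le_rfl ht) hvcont ?_
  · have e1 := hsol s ⟨hs, hst⟩
    have e2 := hsol t ⟨ht, le_rfl⟩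
    rw [← intervalIntegral.integral_add_adjacent_intervals (hh 0 s le_rfl hs) (hh s t hs hst),
      ← intervalIntegral.integral_add_adjacent_intervals (hwp 0 s le_rfl hs) (hwp s t hs hst),
      Real.exp_add (∫ τ in (0:ℝ)..s, |h τ| * |w τ| ^ p), ← mul_assoc, ← e1] at e2
    have hne := (Real.exp_pos (m * t - ((∫ τ in (0:ℝ)..s, |h τ|) + ∫ τ in s..t, |h τ|))).ne'
    apply mul_right_cancel₀ hne
    rw [e2, mul_assoc, mul_assoc, ← Real.exp_add, ← Real.exp_add]
    congr 2
    ring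
  · rintro u ⟨hu0, -⟩
    have hS : ∀ τ ∈ Set.uIcc 0 u,
        Real.exp (-m * (u - τ) + ∫ σ in τ..u, |h σ|) * |h τ| * |w τ| ^ p * w τ =
        Real.exp (-(m * u - ∫ σ in (0:ℝ)..u, |h σ|)) *
          (|h τ| * |w τ| ^ p * (w τ * Real.exp (m * τ - ∫ σ in (0:ℝ)..τ, |h σ|))) := by
      intro τ hτ
      rw [Set.uIcc_of_le hu0] at hτ
      rw [← intervalIntegral.integral_add_adjacent_intervals (hh 0 τ le_rfl hτ.1)
        (hh τ u hτ.1 hτ.2)]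
      rw [show -m * (u - τ) + ∫ σ in τ..u, |h σ| =
        -(m * u - ((∫ σ in (0:ℝ)..τ, |h σ|) + ∫ σ in τ..u, |h σ|)) +
          (m * τ - ∫ σ in (0:ℝ)..τ, |h σ|) by ring, Real.exp_add]
      ring
    have e := hduhamel u hu0
    rw [intervalIntegral.integral_congr hS, intervalIntegral.integral_const_mul,
      show -m * (u - 0) + ∫ τ in (0:ℝ)..u, |h τ| = -(m * u - ∫ σ in (0:ℝ)..u, |h σ|) by ring,
      ← mul_add] at e
    rw [e, mul_right_comm, ← Real.exp_add]
    simp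

theorem nonlinear_remainder_lt {r ρ p R Ch μ₀ : ℝ} (hr : 1 < r) (hρ : 1 < ρ) (hp : 0 < p)
    (hR : 0 < R) (hCh : 0 < Ch)
    (hμ₀ : (ρ ^ (2 * p + 1) * R ^ p * Ch / (ρ ^ ((1 : ℝ) / 2) - 1)) ^ (r / (r - 1)) *
      ((r - 1) / r) * 2 ^ (1 / (r - 1)) ≤ μ₀) :
    (ρ * R) ^ p * (2 * (Ch ^ r * (((r / (r - 1) * μ₀ / (ρ * R) ^ p) ^ (r - 1))⁻¹ / r))) <
      Real.log ρ / 2 := by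
  have hr0 : 0 < r := by linarith
  have hr1 : 0 < r - 1 := by linarith
  have hρ0 : 0 < ρ := by linarith
  have hq : 1 < ρ ^ ((1 : ℝ) / 2) := Real.one_lt_rpow hρ (by norm_num)
  have hq1 : 0 < ρ ^ ((1 : ℝ) / 2) - 1 := by linarith
  set Z := ρ ^ (2 * p + 1) * R ^ p * Ch / (ρ ^ ((1 : ℝ) / 2) - 1) with hZ
  have hZ0 : 0 < Z := by positivity
  set K := (ρ * R) ^ p with hK
  have hK0 : 0 < K := by positivity
  have hμ0 : 0 < μ₀ := lt_of_lt_of_le (by positivity) hμ₀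
  set y := (ρ ^ ((1 : ℝ) / 2) - 1) / ρ ^ (p + 1) with hy
  have hy0 : 0 < y := by positivity
  have hKy : K * Ch = y * Z := by
    rw [hK, hy, hZ, Real.mul_rpow hρ0.le hR.le, show 2 * p + 1 = p + (p + 1) by ring,
      Real.rpow_add hρ0 p (p + 1)]
    field_simp
  have hyle : y ≤ 1 - (ρ ^ ((1 : ℝ) / 2))⁻¹ := by
    have h1 : ρ ^ ((1 : ℝ) / 2) ≤ ρ ^ (p + 1) :=
      Real.rpow_le_rpow_of_exponent_le hρ.le (by linarith)
    calc y ≤ (ρ ^ ((1 : ℝ) / 2) - 1) / ρ ^ ((1 : ℝ) / 2) := by rw [hy]; gcongr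
      _ = _ := by field_simp
  have hylog : y ≤ Real.log ρ / 2 := by
    have h1 := Real.one_sub_inv_le_log_of_pos (show 0 < ρ ^ ((1 : ℝ) / 2) by positivity)
    rw [Real.log_rpow hρ0] at h1
    linarith
  have hy1 : y ≤ 1 := by
    have : 0 < (ρ ^ ((1 : ℝ) / 2))⁻¹ := by positivity
    linarith
  have hyr : y ^ r ≤ y := by
    simpa using Real.rpow_le_rpow_of_exponent_ge hy0 hy1 hr.le
  have hW : Z ^ r * 2 ≤ (r / (r - 1) * μ₀) ^ (r - 1) := by
    have h1 : Z ^ (r / (r - 1)) * 2 ^ (1 / (r - 1)) ≤ r / (r - 1) * μ₀ := by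
      calc _ = r / (r - 1) * (Z ^ (r / (r - 1)) * ((r - 1) / r) * 2 ^ (1 / (r - 1))) := by
            field_simp
        _ ≤ _ := by gcongr
    calc Z ^ r * 2 = (Z ^ (r / (r - 1)) * (2 : ℝ) ^ (1 / (r - 1))) ^ (r - 1) := by
          rw [Real.mul_rpow (by positivity) (by positivity), ← Real.rpow_mul hZ0.le,
            ← Real.rpow_mul (by norm_num), div_mul_cancel₀ _ hr1.ne',
            div_mul_cancel₀ _ hr1.ne', Real.rpow_one]
      _ ≤ _ := by gcongr
  calc K * (2 * (Ch ^ r * (((r / (r - 1) * μ₀ / K) ^ (r - 1))⁻¹ / r)))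
      = 2 * (K * Ch) ^ r / (r * (r / (r - 1) * μ₀) ^ (r - 1)) := by
        rw [Real.div_rpow (by positivity) hK0.le, Real.mul_rpow hK0.le hCh.le,
          Real.rpow_sub hK0, Real.rpow_one]
        field_simp
    _ ≤ 2 * (y * Z) ^ r / (r * (Z ^ r * 2)) := by rw [hKy]; gcongr
    _ = y ^ r / r := by rw [Real.mul_rpow hy0.le hZ0.le]; field_simp
    _ ≤ y / r := by gcongr
    _ < y := div_lt_self hy0 hr
    _ ≤ _ := hylog

/-- Proposition `ode-stab`: a continuous solution `w` of the Duhamel integral equation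
`w(t) = S(t,0) w₀ + ∫_0^t S(t,τ) |h(τ)| |w(τ)|^p w(τ) dτ` (i.e. of the scalar ODE
`ẇ = -(μ̄ - |h|(1 + |w|^p)) w`, `w(0) = w₀`), with `|w₀| ≤ R`, satisfies
`|w(t)| ≤ ρ e^{-μ₀ (t-s)} |w(s)|` for all `t ≥ s ≥ 0`; moreover `μ ≤ μ₀`. -/
theorem stmt_8 (T Ch r : ℝ) (hT : 0 < T) (hCh : 0 < Ch) (hr : 1 < r)
    (h : ℝ → ℝ) (hmeas : Measurable h)
    (hloc : ∀ a b : ℝ, 0 ≤ a → IntegrableOn (fun τ => |h τ| ^ r) (Set.Icc a b))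
    (hbound : ∀ s : ℝ, 0 ≤ s → (∫ τ in s..(s + T), |h τ| ^ r) ≤ Ch ^ r)
    (R p μ ρ c μ₀ μbarstar μbar : ℝ)
    (hR : 0 < R) (hp : 0 < p) (hμ : 0 < μ) (hρ : 1 < ρ) (hc : 1 < c)
    (hμ₀ : μ₀ = max (max μ (Real.log 2 / (p * T)))
      (max ((ρ ^ (2 * p + 1) * R ^ p * Ch / (ρ ^ ((1 : ℝ) / 2) - 1)) ^ (r / (r - 1)) *
          ((r - 1) / r) * 2 ^ (1 / (r - 1)))
        (2 ^ ((r + 1) / (r - 1)) *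
          (ρ ^ (2 * p + 1 / 2) * Ch * ((p + 1) / p) * R ^ p * c) ^ (r / (r - 1)) *
          p ^ (1 / (r - 1)))))
    (hμbarstar : μbarstar =
      max (2 * ((r - 1) / r) * (2 * Ch ^ r / (r * Real.log ρ)) ^ (1 / (r - 1))) (4 * μ₀) +
        T ^ (-1 / r) * Ch)
    (hμbar : μbarstar ≤ μbar)
    (w₀ : ℝ) (hw₀ : |w₀| ≤ R)
    (w : ℝ → ℝ) (hwcont : ContinuousOn w (Set.Ici (0 : ℝ)))
    (hduhamel : ∀ t : ℝ, 0 ≤ t →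
      w t = Real.exp (-μbar * (t - 0) + ∫ τ in (0:ℝ)..t, |h τ|) * w₀ +
        ∫ τ in (0:ℝ)..t,
          Real.exp (-μbar * (t - τ) + ∫ σ in τ..t, |h σ|) * |h τ| * |w τ| ^ p * w τ) :
    (∀ s t : ℝ, 0 ≤ s → s ≤ t → |w t| ≤ ρ * Real.exp (-μ₀ * (t - s)) * |w s|) ∧ μ ≤ μ₀ := by
  have hr0 : 0 < r := by linarith
  have hr1 : 0 < r - 1 := by linarith
  have hρ0 : 0 < ρ := by linarith
  have hlog : 0 < Real.log ρ := Real.log_pos hρ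
  have hμle : μ ≤ μ₀ := hμ₀ ▸ (le_max_left _ _).trans (le_max_left _ _)
  refine ⟨?_, hμle⟩
  have hμ₀pos : 0 < μ₀ := hμ.trans_le hμle
  have hlogT : Real.log 2 / (p * T) ≤ μ₀ :=
    hμ₀ ▸ (le_max_right _ _).trans (le_max_left _ _)
  have hrem := nonlinear_remainder_lt hr hρ hp hR hCh
    (hμ₀ ▸ (le_max_left _ _).trans (le_max_right _ _))
  set K := (ρ * R) ^ p with hK
  have hK0 : 0 < K := by positivity
  set l₂ := r / (r - 1) * μ₀ / K with hl₂
  have hl₂0 : 0 < l₂ := by positivity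
  set δ := K * (2 * (Ch ^ r * ((l₂ ^ (r - 1))⁻¹ / r))) with hδ
  set l₁ := (2 * Ch ^ r / (r * Real.log ρ)) ^ (1 / (r - 1)) with hl₁
  have hl₁0 : 0 < l₁ := by positivity
  have hX₁ : Ch ^ r * ((l₁ ^ (r - 1))⁻¹ / r) = Real.log ρ / 2 := by
    rw [hl₁, ← Real.rpow_mul (by positivity), div_mul_cancel₀ _ hr1.ne', Real.rpow_one]
    field_simp
  have hM₁ := le_max_left (2 * ((r - 1) / r) * l₁) (4 * μ₀)
  have hM₂ := le_max_right (2 * ((r - 1) / r) * l₁) (4 * μ₀)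
  have hmT : Real.exp (-(p * μ₀ * T)) ≤ 1 / 2 := by
    rw [div_le_iff₀ (by positivity)] at hlogT
    rw [one_div, ← Real.exp_log (show (0 : ℝ) < 2 by norm_num), ← Real.exp_neg]
    exact Real.exp_le_exp.2 (by linarith)
  have hh : ∀ s t : ℝ, 0 ≤ s → s ≤ t → IntervalIntegrable (fun τ => |h τ|) volume s t :=
    fun s t hs hst => intervalIntegrable_abs_of_rpow hr hmeas hloc hs hst
  have hdecay : ∀ s t : ℝ, 0 ≤ s → s ≤ t →
      (∀ τ, 0 ≤ τ → τ < t → |w τ| * Real.exp (μ₀ * τ) < ρ * R) →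
      |w t| ≤ |w s| * Real.exp (-μ₀ * (t - s) + (Real.log ρ / 2 + δ)) := by
    intro s t hs hst hw
    have hlin := integral_abs_le hT hCh hr hmeas hloc hbound hs hst hl₁0
    rw [hX₁] at hlin
    have hnl : ∫ τ in s..t, |h τ| * |w τ| ^ p ≤ μ₀ * (t - s) + δ := by
      calc ∫ τ in s..t, |h τ| * |w τ| ^ p
          ≤ ∫ τ in s..t, K * (|h τ| * Real.exp (-(p * μ₀ * (τ - s)))) := by
            refine intervalIntegral.integral_mono_on_of_le_Ioo hst ?_ ?_ fun τ hτ => ?_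
            · refine (hh s t hs hst).mul_continuousOn ?_
              rw [Set.uIcc_of_le hst]
              exact ((hwcont.mono fun x hx => hs.trans hx.1).abs).rpow_const
                fun _ _ => Or.inr hp.le
            · exact ((hh s t hs hst).mul_continuousOn (by fun_prop)).const_mul K
            · have h1 : |w τ| ≤ ρ * R * Real.exp (-(μ₀ * (τ - s))) := by
                have h2 := hw τ (hs.trans hτ.1.le) hτ.2
                have h3 : Real.exp (μ₀ * (τ - s)) ≤ Real.exp (μ₀ * τ) :=
                  Real.exp_le_exp.2 (by gcongr; linarith)
                rw [Real.exp_neg, ← div_eq_mul_inv, le_div_iff₀ (Real.exp_pos _)]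
                exact (mul_le_mul_of_nonneg_left h3 (abs_nonneg _)).trans h2.le
              calc |h τ| * |w τ| ^ p
                  ≤ |h τ| * (ρ * R * Real.exp (-(μ₀ * (τ - s)))) ^ p := by gcongr
                _ = K * (|h τ| * Real.exp (-(p * μ₀ * (τ - s)))) := by
                  rw [Real.mul_rpow (by positivity) (Real.exp_pos _).le, ← Real.exp_mul,
                    show -(μ₀ * (τ - s)) * p = -(p * μ₀ * (τ - s)) by ring]
                  ring
        _ = K * ∫ τ in s..t, |h τ| * Real.exp (-(p * μ₀ * (τ - s))) :=
            intervalIntegral.integral_const_mul _ _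
        _ ≤ K * (l₂ * ((r - 1) / r) * (t - s) + 2 * (Ch ^ r * ((l₂ ^ (r - 1))⁻¹ / r))) := by
            gcongr
            exact integral_abs_mul_exp_le hT hCh hr hmeas hloc hbound hs hst hl₂0
              (by positivity) hmT
        _ = μ₀ * (t - s) + δ := by
            have : K * (l₂ * ((r - 1) / r)) = μ₀ := by rw [hl₂]; field_simp
            rw [mul_add, ← mul_assoc K, this]
    rw [eq_mul_exp_of_duhamel hp hh hwcont hduhamel hs hst, abs_mul, Real.abs_exp]
    refine mul_le_mul_of_nonneg_left (Real.exp_le_exp.2 ?_) (abs_nonneg _)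
    have hts : 0 ≤ t - s := by linarith
    have hrate : T ^ (-1 / r) * Ch + l₁ * ((r - 1) / r) + 2 * μ₀ ≤ μbar := by linarith
    have := mul_le_mul_of_nonneg_right hrate hts
    linarith
  have hδlt : Real.exp (Real.log ρ / 2 + δ) < ρ := by
    rw [← Real.lt_log_iff_exp_lt hρ0]
    linarith
  have hball : ∀ t : ℝ, 0 ≤ t → |w t| * Real.exp (μ₀ * t) < ρ * R := by
    refine lt_of_forall_lt_imp_lt (hwcont.abs.mul (by fun_prop)) fun t ht hw => ?_
    have h0 : w 0 = w₀ := by simpa using hduhamel 0 le_rfl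
    have h1 := hdecay 0 t le_rfl ht hw
    rw [h0] at h1
    calc |w t| * Real.exp (μ₀ * t)
        ≤ |w₀| * Real.exp (-μ₀ * (t - 0) + (Real.log ρ / 2 + δ)) * Real.exp (μ₀ * t) := by
          gcongr
      _ = |w₀| * Real.exp (Real.log ρ / 2 + δ) := by
          rw [mul_assoc, ← Real.exp_add]
          congr 2
          ring
      _ ≤ R * Real.exp (Real.log ρ / 2 + δ) := by gcongr
      _ < R * ρ := by gcongr
      _ = ρ * R := mul_comm _ _
  intro s t hs hst
  refine (hdecay s t hs hst fun τ hτ _ => hball τ hτ).trans ?_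
  rw [Real.exp_add, mul_comm |w s|, mul_comm ρ]
  gcongr
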